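/- Let G be the series composition of multigraphs G1 and G2 at a vertex s, let a ∈ V1 \ {s} and b ∈ V2 \ {s}, and let r_a, r_s, r_b ∈ ℤ with r_a + r_s + r_b = 0. Then mincost(G, [a ↦ r_a, s ↦ r_s, b ↦ r_b]) = mincost(G1, [a ↦ r_a, s ↦ −r_a]) + mincost(G2, [s ↦ r_a + r_s, b ↦ r_b]), where the addition is in ℕ∞. -/

import Mathlib

open scoped BigOperators

/-- An undirected multigraph on vertex type `V` with edge type `E`:
each edge has a reference orientation `src e → tgt e`, a cost `c e` and a capacity `u e`. -/
structure Multigraph (V E : Type) where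
  src : E → V
  tgt : E → V
  c : E → ℕ
  u : E → ℕ

variable {V E : Type}

/-- The residue of a flow assignment `f : E → ℤ` at a vertex `v`:
inflow (w.r.t. the reference orientation) minus outflow. -/
def Multigraph.residue [Fintype E] [DecidableEq V] (G : Multigraph V E)
    (f : E → ℤ) (v : V) : ℤ :=
  (∑ e : E, if G.tgt e = v then f e else 0) - (∑ e : E, if G.src e = v then f e else 0)

/-- `f` is an `r`-circulation supported on `F`: it vanishes outside `F`,
respects capacities, and has residue `r v` at every vertex `v`. -/
def Multigraph.IsCirculation [Fintype E] [DecidableEq V] (G : Multigraph V E)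
    (r : V → ℤ) (F : Finset E) (f : E → ℤ) : Prop :=
  (∀ e, e ∉ F → f e = 0) ∧ (∀ e, |f e| ≤ (G.u e : ℤ)) ∧ (∀ v, G.residue f v = r v)

/-- The minimum cost (in `ℕ∞`) of a subset `F` of the allowed edge set `E'`
admitting an `r`-circulation supported on `F`.  Taking `E' = Finset.univ`
gives `mincost(G, r)`; taking `E' = E₁` for a sub-multigraph `(V₁, E₁)` all of
whose edges have both endpoints in `V₁` gives `mincost(G₁, r)` whenever `r`
vanishes outside `V₁`. -/
noncomputable def Multigraph.mincostOn [Fintype E] [DecidableEq V] (G : Multigraph V E)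
    (E' : Finset E) (r : V → ℤ) : ℕ∞ :=
  ⨅ (F : Finset E) (_ : F ⊆ E' ∧ ∃ f : E → ℤ, G.IsCirculation r F f),
    ((∑ e ∈ F, G.c e : ℕ) : ℕ∞)

namespace Multigraph

variable [Fintype E] [DecidableEq V]

theorem residue_add (G : Multigraph V E) (f g : E → ℤ) (v : V) :
    G.residue (fun e => f e + g e) v = G.residue f v + G.residue g v := by
  simp only [residue, ← Finset.sum_filter, Finset.sum_add_distrib]
  ring

/-- The residues of a flow assignment sum to zero. -/
theorem sum_residue [Fintype V] (G : Multigraph V E) (f : E → ℤ) :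
    ∑ v, G.residue f v = 0 := by
  simp only [residue, Finset.sum_sub_distrib]
  rw [Finset.sum_comm, Finset.sum_comm (f := fun v e => if G.src e = v then f e else 0)]
  simp

theorem residue_eq_zero_of_notMem (G : Multigraph V E) {W : Finset V} {f : E → ℤ}
    (hf : ∀ e, f e ≠ 0 → G.src e ∈ W ∧ G.tgt e ∈ W) {v : V} (hv : v ∉ W) :
    G.residue f v = 0 := by
  have h : ∀ e, f e = 0 ∨ (G.src e ≠ v ∧ G.tgt e ≠ v) := fun e => by
    by_cases h0 : f e = 0
    · exact Or.inl h0
    · exact Or.inr ⟨fun h => hv (h ▸ (hf e h0).1), fun h => hv (h ▸ (hf e h0).2)⟩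
  rw [residue, Finset.sum_eq_zero, Finset.sum_eq_zero, sub_zero]
  all_goals
    intro e _
    rcases h e with h | h <;> simp [h]

theorem mincostOn_le (G : Multigraph V E) {E' F : Finset E} {r : V → ℤ} {f : E → ℤ}
    (hF : F ⊆ E') (hf : G.IsCirculation r F f) :
    G.mincostOn E' r ≤ ((∑ e ∈ F, G.c e : ℕ) : ℕ∞) :=
  iInf₂_le F ⟨hF, f, hf⟩

variable [DecidableEq E]

/-- In a series composition at `s`, restricting a circulation to the first part yields a
circulation whose residue at `s` is forced by the balance condition. -/
theorem IsCirculation.restrict [Fintype V] {G : Multigraph V E} {V1 V2 : Finset V}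
    {E1 E2 : Finset E}
    (hE : E1 ∪ E2 = Finset.univ) (hEdisj : Disjoint E1 E2)
    (hG1 : ∀ e ∈ E1, G.src e ∈ V1 ∧ G.tgt e ∈ V1)
    (hG2 : ∀ e ∈ E2, G.src e ∈ V2 ∧ G.tgt e ∈ V2)
    {s : V} (hVx : V1 ∩ V2 = {s}) {r r1 : V → ℤ}
    (hr : ∀ v ∈ V1, v ≠ s → r v = r1 v) (hr1 : ∀ v ∉ V1, r1 v = 0) (hsum : ∑ v, r1 v = 0)
    {F : Finset E} {f : E → ℤ} (hf : G.IsCirculation r F f) :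
    G.IsCirculation r1 (F ∩ E1) (fun e => if e ∈ E1 then f e else 0) := by
  obtain ⟨hsupp, hcap, hres⟩ := hf
  have hoff : ∀ v, v ≠ s → G.residue (fun e => if e ∈ E1 then f e else 0) v = r1 v := by
    intro v hvs
    by_cases hv : v ∈ V1
    · have hv2 : v ∉ V2 := fun h2 =>
        hvs (Finset.mem_singleton.1 (hVx ▸ Finset.mem_inter.2 ⟨hv, h2⟩))
      have hz : G.residue (fun e => if e ∈ E2 then f e else 0) v = 0 :=
        G.residue_eq_zero_of_notMem
          (fun e he => hG2 e (by by_contra h; simp [h] at he)) hv2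
      have hsplit : f = fun e => (if e ∈ E1 then f e else 0) + (if e ∈ E2 then f e else 0) := by
        funext e
        have h12 : e ∈ E1 ∪ E2 := hE ▸ Finset.mem_univ e
        have hd : e ∈ E1 → e ∉ E2 := fun h => Finset.disjoint_left.1 hEdisj h
        by_cases h1 : e ∈ E1
        · simp [h1, hd h1]
        · simp [h1, (Finset.mem_union.1 h12).resolve_left h1]
      have h := hres v
      rw [hsplit, residue_add, hz, add_zero] at h
      rw [h, hr v hv hvs]
    · rw [hr1 v hv]
      exact G.residue_eq_zero_of_notMem
        (fun e he => hG1 e (by by_contra h; simp [h] at he)) hv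
  refine ⟨fun e he => ?_, fun e => ?_, fun v => ?_⟩
  · by_cases h1 : e ∈ E1
    · simp [h1, hsupp e fun h => he (Finset.mem_inter.2 ⟨h, h1⟩)]
    · simp [h1]
  · dsimp only
    split_ifs
    · exact hcap e
    · simp
  · by_cases hvs : v = s
    · subst hvs
      have h := G.sum_residue (fun e => if e ∈ E1 then f e else 0)
      rw [← Finset.add_sum_erase _ _ (Finset.mem_univ v)] at h hsum
      rw [Finset.sum_congr rfl fun w hw => hoff w (Finset.ne_of_mem_erase hw)] at h
      linarith
    · exact hoff v hvs

theorem IsCirculation.add {G : Multigraph V E} {F1 F2 : Finset E} (hF : Disjoint F1 F2)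
    {r1 r2 : V → ℤ} {f1 f2 : E → ℤ} (h1 : G.IsCirculation r1 F1 f1)
    (h2 : G.IsCirculation r2 F2 f2) :
    G.IsCirculation (fun v => r1 v + r2 v) (F1 ∪ F2) (fun e => f1 e + f2 e) := by
  refine ⟨fun e he => ?_, fun e => ?_, fun v => ?_⟩
  · rw [Finset.mem_union, not_or] at he
    simp [h1.1 e he.1, h2.1 e he.2]
  · by_cases he : e ∈ F1
    · simpa [h2.1 e (Finset.disjoint_left.1 hF he)] using h1.2.1 e
    · simpa [h1.1 e he] using h2.2.1 e
  · rw [residue_add, h1.2.2, h2.2.2]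

/-- The minimum cost over a series composition is additive, when the residue function is split
into balanced residue functions on the two parts. -/
theorem mincostOn_series [Fintype V] (G : Multigraph V E) {V1 V2 : Finset V} {E1 E2 : Finset E}
    (hE : E1 ∪ E2 = Finset.univ) (hEdisj : Disjoint E1 E2)
    (hG1 : ∀ e ∈ E1, G.src e ∈ V1 ∧ G.tgt e ∈ V1)
    (hG2 : ∀ e ∈ E2, G.src e ∈ V2 ∧ G.tgt e ∈ V2)
    {s : V} (hVx : V1 ∩ V2 = {s}) {r1 r2 : V → ℤ}
    (hr1 : ∀ v ∉ V1, r1 v = 0) (hr2 : ∀ v ∉ V2, r2 v = 0)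
    (hsum1 : ∑ v, r1 v = 0) (hsum2 : ∑ v, r2 v = 0) :
    G.mincostOn Finset.univ (fun v => r1 v + r2 v) = G.mincostOn E1 r1 + G.mincostOn E2 r2 := by
  have hinter : ∀ v ∈ V1, v ∈ V2 → v = s := fun v h h' =>
    Finset.mem_singleton.1 (hVx ▸ Finset.mem_inter.2 ⟨h, h'⟩)
  apply le_antisymm
  · refine ENat.le_iInf₂_add_iInf₂ fun F1 ⟨hF1, f1, hf1⟩ F2 ⟨hF2, f2, hf2⟩ => ?_
    have hd : Disjoint F1 F2 := hEdisj.mono hF1 hF2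
    refine (G.mincostOn_le (Finset.subset_univ _) (hf1.add hd hf2)).trans_eq ?_
    rw [Finset.sum_union hd, Nat.cast_add]
  · refine le_iInf₂ fun F ⟨_, f, hf⟩ => ?_
    have hc1 := hf.restrict hE hEdisj hG1 hG2 hVx (r1 := r1)
      (fun v hv hvs => by simp [hr2 v fun h => hvs (hinter v hv h)]) hr1 hsum1
    have hc2 := hf.restrict (by rwa [Finset.union_comm]) hEdisj.symm hG2 hG1
      (by rwa [Finset.inter_comm]) (r1 := r2)
      (fun v hv hvs => by simp [hr1 v fun h => hvs (hinter v h hv)]) hr2 hsum2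
    refine (add_le_add (G.mincostOn_le Finset.inter_subset_right hc1)
      (G.mincostOn_le Finset.inter_subset_right hc2)).trans_eq ?_
    rw [← Nat.cast_add, ← Finset.sum_union
      (hEdisj.mono Finset.inter_subset_right Finset.inter_subset_right),
      ← Finset.inter_union_distrib_left, hE, Finset.inter_univ]

end Multigraph

/-- Case 2.1: series composition splitting at `s`, 3-tuple of residues. -/
theorem series_three_tuple_split_at_s {V E : Type}
    [Fintype V] [Fintype E] [DecidableEq V] [DecidableEq E]
    (G : Multigraph V E) (V1 V2 : Finset V) (E1 E2 : Finset E)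
    (hE : E1 ∪ E2 = Finset.univ) (hEdisj : Disjoint E1 E2)
    (hV : V1 ∪ V2 = Finset.univ)
    (hG1 : ∀ e ∈ E1, G.src e ∈ V1 ∧ G.tgt e ∈ V1)
    (hG2 : ∀ e ∈ E2, G.src e ∈ V2 ∧ G.tgt e ∈ V2)
    (s a b : V) (hVx : V1 ∩ V2 = {s})
    (ha : a ∈ V1) (has : a ≠ s) (hb : b ∈ V2) (hbs : b ≠ s)
    (ra rs rb : ℤ) (hsum : ra + rs + rb = 0) :
    G.mincostOn Finset.univ
        (fun v => if v = a then ra else if v = s then rs else if v = b then rb else 0) =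
      G.mincostOn E1 (fun v => if v = a then ra else if v = s then -ra else 0) +
      G.mincostOn E2 (fun v => if v = s then ra + rs else if v = b then rb else 0) := by
  have hab : a ≠ b := fun h =>
    has (Finset.mem_singleton.1 (hVx ▸ Finset.mem_inter.2 ⟨ha, h ▸ hb⟩))
  have hs : s ∈ V1 ∩ V2 := hVx ▸ Finset.mem_singleton_self s
  rw [Finset.mem_inter] at hs
  have hpair : ∀ {x y : V}, x ≠ y → ∀ p q : ℤ,
      ∑ v, (if v = x then p else if v = y then q else 0) = p + q := by
    intro x y hxy p q
    rw [Finset.sum_eq_add x y hxy] <;> simp +contextual [hxy.symm]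
  rw [← G.mincostOn_series hE hEdisj hG1 hG2 hVx]
  · congr 1
    funext v
    grind
  · intro v hv
    grind
  · intro v hv
    grind
  · rw [hpair has]
    ring
  · rw [hpair hbs.symm]
    exact hsum
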